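/- arXiv:1212.2522 — 2 statements merged into one kernel-verified Lean document; each statement's English description precedes it below -/
import Mathlib

section
/- Let E be a nonzero real Banach space and A be a closed linear monotone subspace of E × E*. Then the following four conditions are equivalent: (i) the adjoint subspace Aᵀ is a monotone subspace of E** × E*; (ii) A is maximally monotone and of type (NI); (iii) A is of type (NI); (iv) Aᵀ is a maximally monotone subspace of E** × E*. -/
open NormedSpace

variable {E : Type*} [NormedAddCommGroup E] [NormedSpace ℝ E]

/-- A subset `A` of `E × E*` is monotone: `A ≠ ∅` and
`⟨x - y, x* - y*⟩ ≥ 0` for all `(x, x*), (y, y*) ∈ A`. -/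
def MonoSet (A : Set (E × StrongDual ℝ E)) : Prop :=
  A.Nonempty ∧ ∀ p ∈ A, ∀ q ∈ A, 0 ≤ (p.2 - q.2) (p.1 - q.1)

/-- `A` is a maximally monotone subset of `E × E*`. -/
def MaxMonoSet (A : Set (E × StrongDual ℝ E)) : Prop :=
  MonoSet A ∧ ∀ C : Set (E × StrongDual ℝ E), MonoSet C → A ⊆ C → C = A

/-- A subset `S` of `E** × E*` is monotone: `S ≠ ∅` and
`⟨x* - y*, x** - y**⟩ ≥ 0` for all `(x**, x*), (y**, y*) ∈ S`. -/
def MonoSetBi (S : Set (StrongDual ℝ (StrongDual ℝ E) × StrongDual ℝ E)) : Prop :=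
  S.Nonempty ∧ ∀ p ∈ S, ∀ q ∈ S, 0 ≤ (p.1 - q.1) (p.2 - q.2)

/-- `S` is a maximally monotone subset of `E** × E*`. -/
def MaxMonoSetBi (S : Set (StrongDual ℝ (StrongDual ℝ E) × StrongDual ℝ E)) : Prop :=
  MonoSetBi S ∧ ∀ C : Set (StrongDual ℝ (StrongDual ℝ E) × StrongDual ℝ E), MonoSetBi C → S ⊆ C → C = S

/-- The adjoint subspace `Aᵀ ⊆ E** × E*` of a linear subspace `A ⊆ E × E*`:
`(y**, y*) ∈ Aᵀ ↔ ⟨a, y*⟩ = ⟨a*, y**⟩ for all (a, a*) ∈ A`. -/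
def adjointSubspace (A : Set (E × StrongDual ℝ E)) : Set (StrongDual ℝ (StrongDual ℝ E) × StrongDual ℝ E) :=
  {p | ∀ a ∈ A, p.2 a.1 = p.1 a.2}

/-- `A ⊆ E × E*` is of type (NI): for all `(y*, y**) ∈ E* × E**`,
`inf_{(x, x*) ∈ A} ⟨x* - y*, x̂ - y**⟩ ≤ 0`. -/
def TypeNI (A : Set (E × StrongDual ℝ E)) : Prop :=
  ∀ (y₁ : StrongDual ℝ E) (y₂ : StrongDual ℝ (StrongDual ℝ E)),
    sInf ((fun p => (inclusionInDoubleDual ℝ E p.1 - y₂) (p.2 - y₁)) '' A) ≤ 0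

/-- A convex function on a set and a continuous convex function whose sum is at least `m` on that
set can be separated by a continuous linear functional (Fenchel duality). -/
theorem exists_dual_separation {V : Type*} [NormedAddCommGroup V] [NormedSpace ℝ V]
    {S : Set V} (hS : S.Nonempty) {f k : V → ℝ} (hf : ConvexOn ℝ S f)
    (hk : ConvexOn ℝ Set.univ k) (hkc : Continuous k) {m : ℝ}
    (hm : ∀ a ∈ S, m ≤ f a + k a) :
    ∃ (w : StrongDual ℝ V) (μ : ℝ), (∀ b, μ ≤ k b - w b) ∧ ∀ a ∈ S, m - μ ≤ f a + w a := by
  have hconv₁ : Convex ℝ {p : V × ℝ | k p.1 < p.2} := by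
    simpa using hk.convex_strict_epigraph
  have hopen : IsOpen {p : V × ℝ | k p.1 < p.2} :=
    isOpen_lt (hkc.comp continuous_fst) continuous_snd
  have hconv₂ : Convex ℝ {p : V × ℝ | p.1 ∈ S ∧ p.2 ≤ m - f p.1} := by
    have : ConcaveOn ℝ S (fun x => m - f x) := (concaveOn_const m hf.1).sub hf
    exact this.convex_hypograph
  have hdisj : Disjoint {p : V × ℝ | k p.1 < p.2} {p : V × ℝ | p.1 ∈ S ∧ p.2 ≤ m - f p.1} := by
    rw [Set.disjoint_left]
    rintro ⟨a, t⟩ h₁ ⟨h₂, h₃⟩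
    have := hm a h₂
    simp only [Set.mem_ofPred_eq] at h₁ h₃
    linarith
  obtain ⟨F, u, hFu, huF⟩ := geometric_hahn_banach_open hconv₁ hopen hconv₂ hdisj
  set φ : StrongDual ℝ V := F.comp (.inl ℝ V ℝ)
  set ρ : ℝ := F (0, 1)
  have hF : ∀ b t, F (b, t) = φ b + t * ρ := by
    intro b t
    have : ((b, t) : V × ℝ) = (b, 0) + t • (0, 1) := by simp
    rw [this, map_add, map_smul, smul_eq_mul]
    rfl
  have h₁ : ∀ b t, k b < t → φ b + t * ρ < u := fun b t h => hF b t ▸ hFu (b, t) h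
  have h₂ : ∀ a ∈ S, u ≤ φ a + (m - f a) * ρ := fun a ha =>
    hF a _ ▸ huF (a, m - f a) ⟨ha, le_rfl⟩
  have hρ : ρ < 0 := by
    obtain ⟨a, ha⟩ := hS
    have e₁ := h₁ a (k a + 1) (by linarith)
    have e₂ := h₂ a ha
    have e₃ := hm a ha
    by_contra! h
    nlinarith
  have hρ' : ρ ≠ 0 := hρ.ne
  have h₃ : ∀ b, φ b + k b * ρ ≤ u := by
    intro b
    have hlim : Filter.Tendsto (fun t : ℝ => φ b + t * ρ) (nhdsWithin (k b) (Set.Ioi (k b)))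
        (nhds (φ b + k b * ρ)) :=
      ((by fun_prop : Continuous fun t : ℝ => φ b + t * ρ).tendsto _).mono_left
        nhdsWithin_le_nhds
    refine le_of_tendsto hlim ?_
    filter_upwards [self_mem_nhdsWithin] with t ht using (h₁ b t ht).le
  refine ⟨-(ρ⁻¹ • φ), u / ρ, fun b => ?_, fun a ha => ?_⟩
  · rw [div_le_iff_of_neg hρ]
    have : (k b - (-(ρ⁻¹ • φ)) b) * ρ = φ b + k b * ρ := by
      simp only [neg_apply, smul_apply, smul_eq_mul]
      field_simp
      ring
    rw [this]
    exact h₃ b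
  · have e : (φ a + (m - f a) * ρ) / ρ ≤ u / ρ := div_le_div_of_nonpos_of_le hρ.le (h₂ a ha)
    have : (φ a + (m - f a) * ρ) / ρ = ρ⁻¹ * φ a + (m - f a) := by
      field_simp
    simp only [neg_apply, smul_apply, smul_eq_mul]
    linarith

/-- The conjugate of half the squared norm is at least half the squared dual norm. -/
theorem exists_half_sq_norm_sub_lt {V : Type*} [NormedAddCommGroup V] [NormedSpace ℝ V]
    (f : StrongDual ℝ V) {η : ℝ} (hη : 0 < η) :
    ∃ z, ‖z‖ ^ 2 / 2 - f z < -(‖f‖ ^ 2 / 2) + η := by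
  rcases eq_or_ne f 0 with rfl | hf
  · exact ⟨0, by simpa using hη⟩
  have hpos : 0 < ‖f‖ := norm_pos_iff.2 hf
  obtain ⟨x, hx, hfx⟩ := f.exists_lt_apply_of_lt_opNorm
    (r := ‖f‖ - η / ‖f‖) (by have := div_pos hη hpos; linarith)
  have hscale : ‖f‖ * (η / ‖f‖) = η := by field_simp
  have hmain : ∀ z : V, ‖z‖ < 1 → ‖f‖ - η / ‖f‖ < f z →
      ∃ z, ‖z‖ ^ 2 / 2 - f z < -(‖f‖ ^ 2 / 2) + η := by
    intro z hz hfz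
    refine ⟨‖f‖ • z, ?_⟩
    rw [norm_smul, map_smul, smul_eq_mul, norm_norm]
    have h₁ : ‖f‖ * (‖f‖ - η / ‖f‖) < ‖f‖ * f z := mul_lt_mul_of_pos_left hfz hpos
    have h₂ : (‖f‖ * ‖z‖) ^ 2 ≤ ‖f‖ ^ 2 := by
      gcongr
      nlinarith
    nlinarith
  rcases le_total 0 (f x) with h | h
  · exact hmain x hx (by rwa [Real.norm_of_nonneg h] at hfx)
  · exact hmain (-x) (by simpa) (by rwa [Real.norm_of_nonpos h, ← map_neg] at hfx)

theorem le_apply_zero_of_forall_pos {g : ℝ → ℝ} (hg : Continuous g) {c : ℝ}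
    (h : ∀ δ, 0 < δ → δ ≤ 1 → c ≤ g δ) : c ≤ g 0 := by
  have hlim : Filter.Tendsto g (nhdsWithin 0 (Set.Ioi 0)) (nhds (g 0)) :=
    (hg.tendsto 0).mono_left nhdsWithin_le_nhds
  refine ge_of_tendsto hlim ?_
  filter_upwards [Ioc_mem_nhdsGT (zero_lt_one' ℝ)] with δ hδ using h δ hδ.1 hδ.2

/-- The restriction to `E` of a functional on `E × E*`. -/
noncomputable def dualFst (W : StrongDual ℝ (E × StrongDual ℝ E)) : StrongDual ℝ E :=
  W.comp (.inl ℝ E (StrongDual ℝ E))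

/-- The restriction to `E*` of a functional on `E × E*`. -/
noncomputable def dualSnd (W : StrongDual ℝ (E × StrongDual ℝ E)) : StrongDual ℝ (StrongDual ℝ E) :=
  W.comp (.inr ℝ E (StrongDual ℝ E))

theorem dual_apply_eq (W : StrongDual ℝ (E × StrongDual ℝ E)) (a : E × StrongDual ℝ E) :
    W a = dualFst W a.1 + dualSnd W a.2 := by
  simp [dualFst, dualSnd, ← map_add]

theorem norm_dualFst_le (W : StrongDual ℝ (E × StrongDual ℝ E)) : ‖dualFst W‖ ≤ ‖W‖ := by
  refine ContinuousLinearMap.opNorm_le_bound _ (norm_nonneg W) fun x => ?_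
  simpa [dualFst] using W.le_opNorm (x, 0)

theorem norm_dualSnd_le (W : StrongDual ℝ (E × StrongDual ℝ E)) : ‖dualSnd W‖ ≤ ‖W‖ := by
  refine ContinuousLinearMap.opNorm_le_bound _ (norm_nonneg W) fun x => ?_
  simpa [dualSnd] using W.le_opNorm (0, x)

theorem abs_dualSnd_dualFst_le (V W : StrongDual ℝ (E × StrongDual ℝ E)) :
    |dualSnd V (dualFst W)| ≤ ‖V‖ * ‖W‖ :=
  ((dualSnd V).le_opNorm _).trans <|
    mul_le_mul (norm_dualSnd_le V) (norm_dualFst_le W) (norm_nonneg _) (norm_nonneg V)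

theorem neg_half_sq_norm_le (W : StrongDual ℝ (E × StrongDual ℝ E)) :
    -(‖dualFst W‖ ^ 2 / 2 + ‖dualSnd W‖ ^ 2 / 2) ≤ dualSnd W (dualFst W) := by
  have h := (abs_le.1 ((dualSnd W).le_opNorm (dualFst W))).1
  nlinarith [sq_nonneg (‖dualFst W‖ - ‖dualSnd W‖)]

/-- Half the squared Euclidean norm of the product `E × E*`. -/
noncomputable def halfSq (a : E × StrongDual ℝ E) : ℝ := ‖a.1‖ ^ 2 / 2 + ‖a.2‖ ^ 2 / 2

theorem continuous_halfSq : Continuous (halfSq (E := E)) := by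
  unfold halfSq
  fun_prop

theorem convexOn_halfSq : ConvexOn ℝ Set.univ (halfSq (E := E)) := by
  have h : ∀ {V : Type _} [NormedAddCommGroup V] [NormedSpace ℝ V],
      ConvexOn ℝ Set.univ (fun x : V => ‖x‖ ^ 2 / 2) := by
    intro V _ _
    have := (convexOn_univ_norm (E := V)).pow (fun _ _ => norm_nonneg _) 2
    simpa [div_eq_inv_mul] using this.smul (by norm_num : (0 : ℝ) ≤ 2⁻¹)
  exact (h.comp_linearMap (LinearMap.fst ℝ E (StrongDual ℝ E))).add
    ((h (V := E →L[ℝ] ℝ)).comp_linearMap (LinearMap.snd ℝ E (StrongDual ℝ E)))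

theorem sq_norm_le_two_mul_halfSq (a : E × StrongDual ℝ E) : ‖a‖ ^ 2 ≤ 2 * halfSq a := by
  unfold halfSq
  rcases le_total ‖a.1‖ ‖a.2‖ with h | h
  · rw [Prod.norm_def, max_eq_right h]; nlinarith [sq_nonneg ‖a.1‖]
  · rw [Prod.norm_def, max_eq_left h]; nlinarith [sq_nonneg ‖a.2‖]

theorem le_neg_of_forall_le_halfSq_sub {W : StrongDual ℝ (E × StrongDual ℝ E)} {μ : ℝ}
    (h : ∀ b, μ ≤ halfSq b - W b) : μ ≤ -(‖dualFst W‖ ^ 2 / 2 + ‖dualSnd W‖ ^ 2 / 2) := by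
  refine le_of_forall_pos_le_add fun η hη => ?_
  obtain ⟨x, hx⟩ := exists_half_sq_norm_sub_lt (dualFst W) (half_pos hη)
  obtain ⟨y, hy⟩ := exists_half_sq_norm_sub_lt (dualSnd W) (half_pos hη)
  have := h (x, y)
  rw [dual_apply_eq] at this
  simp only [halfSq] at this
  linarith

theorem neg_half_sq_norm_le_halfSq_sub (W : StrongDual ℝ (E × StrongDual ℝ E))
    (b : E × StrongDual ℝ E) :
    -(‖dualFst W‖ ^ 2 / 2 + ‖dualSnd W‖ ^ 2 / 2) ≤ halfSq b - W b := by
  rw [dual_apply_eq, halfSq]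
  have h₁ := (le_abs_self _).trans ((dualFst W).le_opNorm b.1)
  have h₂ := (le_abs_self _).trans ((dualSnd W).le_opNorm b.2)
  nlinarith [sq_nonneg (‖dualFst W‖ - ‖b.1‖), sq_nonneg (‖dualSnd W‖ - ‖b.2‖)]

section Monotone

variable {A : Submodule ℝ (E × StrongDual ℝ E)}

theorem MonoSet.apply_nonneg (hA : MonoSet (A : Set (E × StrongDual ℝ E)))
    {a : E × StrongDual ℝ E} (ha : a ∈ A) : 0 ≤ a.2 a.1 := by
  simpa using hA.2 a ha 0 A.zero_mem

theorem MonoSet.convexOn (hA : MonoSet (A : Set (E × StrongDual ℝ E))) :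
    ConvexOn ℝ (A : Set (E × StrongDual ℝ E)) (fun a => a.2 a.1) := by
  refine ⟨A.convex, fun a ha b hb s t hs ht hst => ?_⟩
  have h := mul_nonneg (mul_nonneg hs ht) (hA.2 a ha b hb)
  obtain rfl : t = 1 - s := by linarith
  simp only [Prod.snd_add, Prod.smul_snd, Prod.fst_add, Prod.smul_fst, map_add, map_smul,
    add_apply, smul_apply, smul_eq_mul, map_sub,
    sub_apply] at h ⊢
  nlinarith

/-- At an approximate minimiser `a` over `A` of `⟨x, x*⟩ - L`, the derivative extends from `A` to a
small functional on the whole space. -/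
theorem exists_extension_of_forall_sub_le
    (L : StrongDual ℝ (E × StrongDual ℝ E)) {a : E × StrongDual ℝ E} (ha : a ∈ A)
    {δ : ℝ} (hδ : 0 ≤ δ) (hmin : ∀ b ∈ A, a.2 a.1 - L a - δ ^ 2 ≤ b.2 b.1 - L b) :
    ∃ W : StrongDual ℝ (E × StrongDual ℝ E), ‖W‖ ≤ 2 * δ ∧ (W a) ^ 2 ≤ 4 * δ ^ 2 * a.2 a.1 ∧
      ∀ b ∈ A, W b = a.2 b.1 + b.2 a.1 - L b := by
  let g : (E × StrongDual ℝ E) →ₗ[ℝ] ℝ :=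
    { toFun := fun b => a.2 b.1 + b.2 a.1 - L b
      map_add' := fun x y => by simp; ring
      map_smul' := fun c x => by simp; ring }
  have hg : ∀ b, g b = a.2 b.1 + b.2 a.1 - L b := fun _ => rfl
  have hsq : ∀ b ∈ A, (g b) ^ 2 ≤ 4 * δ ^ 2 * b.2 b.1 := by
    intro b hb
    have := discrim_le_zero (a := b.2 b.1) (b := g b) (c := δ ^ 2) fun t => by
      have h := hmin (a + t • b) (A.add_mem ha (A.smul_mem t hb))
      simp only [Prod.snd_add, Prod.smul_snd, Prod.fst_add, Prod.smul_fst, map_add, map_smul,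
        add_apply, smul_apply, smul_eq_mul] at h
      rw [hg]
      linarith
    rw [discrim] at this
    linarith
  have hbound : ∀ b : A, ‖(g.domRestrict A) b‖ ≤ 2 * δ * ‖b‖ := by
    rintro ⟨b, hb⟩
    refine abs_le_of_sq_le_sq ?_ (by positivity)
    have h₁ : b.2 b.1 ≤ ‖b‖ * ‖b‖ := (le_abs_self _).trans <| (b.2.le_opNorm b.1).trans <|
      mul_le_mul (norm_snd_le b) (norm_fst_le b) (norm_nonneg _) (norm_nonneg _)
    have h₂ := mul_le_mul_of_nonneg_left h₁ (by positivity : 0 ≤ 4 * δ ^ 2)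
    calc (g b) ^ 2 ≤ 4 * δ ^ 2 * b.2 b.1 := hsq b hb
      _ ≤ (2 * δ * ‖b‖) ^ 2 := by linarith
  obtain ⟨W, hW, hWn⟩ := exists_extension_norm_eq A ((g.domRestrict A).mkContinuous _ hbound)
  have hWA : ∀ b ∈ A, W b = g b := fun b hb => hW ⟨b, hb⟩
  exact ⟨W, hWn ▸ LinearMap.mkContinuous_norm_le _ (by positivity) _,
    hWA a ha ▸ hsq a ha, fun b hb => hWA b hb⟩

/-- If `y` is monotonically related to `Aᵀ`, and `y` twisted by a sign plus `W` agrees on `A`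
with the functional induced by `a`, then `a - W` has nonpositive self-pairing. -/
theorem apply_sub_add_le_zero {y : StrongDual ℝ (StrongDual ℝ E) × StrongDual ℝ E}
    (hy : ∀ z ∈ adjointSubspace (A : Set (E × StrongDual ℝ E)), 0 ≤ (z.1 - y.1) (z.2 - y.2))
    {W : StrongDual ℝ (E × StrongDual ℝ E)} {a : E × StrongDual ℝ E}
    (h : ∀ b ∈ A, a.2 b.1 + b.2 a.1 = y.2 b.1 - y.1 b.2 + W b) :
    a.2 a.1 - W a + dualSnd W (dualFst W) ≤ 0 := by
  have := hy (inclusionInDoubleDual ℝ E a.1 + y.1 - dualSnd W, y.2 + dualFst W - a.2) <| by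
    intro b hb
    have := h b hb
    rw [dual_apply_eq] at this
    simp only [add_apply, sub_apply, dual_def]
    linarith
  rw [dual_apply_eq]
  simp only [add_apply, sub_apply, dual_def,
    map_add, map_sub] at this ⊢
  linarith

theorem TypeNI.exists_lt (hNI : TypeNI (A : Set (E × StrongDual ℝ E)))
    (y₁ : StrongDual ℝ E) (y₂ : StrongDual ℝ (StrongDual ℝ E)) {η : ℝ} (hη : 0 < η) :
    ∃ a ∈ A, a.2 a.1 - y₁ a.1 - y₂ a.2 + y₂ y₁ < η := by
  by_contra! h
  have : η ≤ sInf ((fun p => (inclusionInDoubleDual ℝ E p.1 - y₂) (p.2 - y₁)) ''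
      (A : Set (E × StrongDual ℝ E))) := by
    refine le_csInf ⟨_, 0, A.zero_mem, rfl⟩ ?_
    rintro _ ⟨a, ha, rfl⟩
    have := h a ha
    simp only [sub_apply, dual_def, map_sub]
    linarith
  linarith [hNI y₁ y₂]

theorem typeNI_of_forall_exists_lt
    (h : ∀ (y₁ : StrongDual ℝ E) (y₂ : StrongDual ℝ (StrongDual ℝ E)) (η : ℝ), 0 < η →
      ∃ a ∈ A, a.2 a.1 - y₁ a.1 - y₂ a.2 + y₂ y₁ < η) :
    TypeNI (A : Set (E × StrongDual ℝ E)) := by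
  intro y₁ y₂
  by_contra! hpos
  obtain ⟨a, ha, hlt⟩ := h y₁ y₂ _ hpos
  have hbdd : BddBelow ((fun p => (inclusionInDoubleDual ℝ E p.1 - y₂) (p.2 - y₁)) ''
      (A : Set (E × StrongDual ℝ E))) := by
    by_contra hb
    rw [Real.sInf_of_not_bddBelow hb] at hpos
    exact lt_irrefl _ hpos
  have := csInf_le hbdd ⟨a, ha, rfl⟩
  simp only [sub_apply, dual_def, map_sub] at this hlt
  linarith

theorem zero_mem_adjointSubspace : 0 ∈ adjointSubspace (A : Set (E × StrongDual ℝ E)) :=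
  fun _ _ => rfl

theorem TypeNI.monoSetBi_adjointSubspace (hA : MonoSet (A : Set (E × StrongDual ℝ E)))
    (hNI : TypeNI (A : Set (E × StrongDual ℝ E))) :
    MonoSetBi (adjointSubspace (A : Set (E × StrongDual ℝ E))) := by
  refine ⟨⟨0, zero_mem_adjointSubspace⟩, fun p hp r hr => ?_⟩
  refine le_of_forall_pos_le_add fun η hη => ?_
  obtain ⟨a, ha, hlt⟩ := hNI.exists_lt (p.2 - r.2) (-(p.1 - r.1)) hη
  have h₁ := hp a ha
  have h₂ := hr a ha
  have h₃ := hA.apply_nonneg ha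
  simp only [sub_apply, neg_apply, map_sub] at hlt ⊢
  linarith

theorem MonoSetBi.typeNI (hA : MonoSet (A : Set (E × StrongDual ℝ E)))
    (hT : MonoSetBi (adjointSubspace (A : Set (E × StrongDual ℝ E)))) :
    TypeNI (A : Set (E × StrongDual ℝ E)) := by
  refine typeNI_of_forall_exists_lt fun y₁ y₂ η hη => ?_
  by_contra! hge
  set L : StrongDual ℝ (E × StrongDual ℝ E) := y₁.coprod y₂
  have hL₁ : dualFst L = y₁ := by ext; simp [dualFst, L]
  have hL₂ : dualSnd L = y₂ := by ext; simp [dualSnd, L]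
  have hL : ∀ a, L a = y₁ a.1 + y₂ a.2 := fun a => by simp [L]
  have hzero : ∀ z ∈ adjointSubspace (A : Set (E × StrongDual ℝ E)),
      0 ≤ (z.1 - (0 : StrongDual ℝ (StrongDual ℝ E) × StrongDual ℝ E).1)
        (z.2 - (0 : StrongDual ℝ (StrongDual ℝ E) × StrongDual ℝ E).2) :=
    fun z hz => hT.2 z hz 0 zero_mem_adjointSubspace
  set S : Set ℝ := (fun a => a.2 a.1 - L a) '' (A : Set (E × StrongDual ℝ E))
  have hSne : S.Nonempty := ⟨_, 0, A.zero_mem, rfl⟩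
  have hSb : BddBelow S := by
    refine ⟨η - y₂ y₁, ?_⟩
    rintro _ ⟨a, ha, rfl⟩
    have := hge a ha
    simp only [hL]
    linarith
  have key : ∀ δ : ℝ, 0 < δ → δ ≤ 1 →
      η ≤ δ * (1 + 2 * (2 + |y₂ y₁|)) + 4 * δ * ‖L‖ + 4 * δ ^ 2 := by
    intro δ hδ hδ1
    obtain ⟨_, ⟨a, ha, rfl⟩, hlt⟩ := exists_lt_of_csInf_lt hSne
      (lt_add_of_pos_right (sInf S) (pow_pos hδ 2))
    obtain ⟨W, hWn, hWa, hWA⟩ := exists_extension_of_forall_sub_le L ha hδ.le fun b hb => by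
      have := csInf_le hSb ⟨b, hb, rfl⟩
      simp only at this hlt
      linarith
    have h₁ := apply_sub_add_le_zero (A := A) (W := L + W) hzero (a := a) fun b hb => by
      rw [add_apply, hWA b hb]
      simp
    have h₂ := hWA a ha
    have h₃ := hge a ha
    have hq := hA.apply_nonneg ha
    have e₁ := (abs_le.1 (abs_dualSnd_dualFst_le L W)).1
    have e₂ := (abs_le.1 (abs_dualSnd_dualFst_le W L)).1
    have e₃ := (abs_le.1 (abs_dualSnd_dualFst_le W W)).1
    have hLn := norm_nonneg L
    have hWn' := norm_nonneg W
    have e₄ : ‖L‖ * ‖W‖ ≤ ‖L‖ * (2 * δ) := by gcongr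
    have e₅ : ‖W‖ * ‖W‖ ≤ (2 * δ) * (2 * δ) := by gcongr
    have hexp : dualSnd (L + W) (dualFst (L + W)) = dualSnd L (dualFst L) + dualSnd L (dualFst W)
        + dualSnd W (dualFst L) + dualSnd W (dualFst W) := by
      change (dualSnd L + dualSnd W) (dualFst L + dualFst W) = _
      simp only [map_add, add_apply]
      ring
    rw [hexp, add_apply, hL₁, hL₂] at h₁
    rw [hL₂] at e₁
    rw [hL₁] at e₂
    rw [hL] at h₁ h₂
    have hWle : W a ≤ δ * (1 + a.2 a.1) := by
      refine le_of_sq_le_sq ?_ (by positivity)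
      nlinarith [mul_nonneg (sq_nonneg δ) (sq_nonneg (1 - a.2 a.1))]
    have hWle' : W a ≤ a.2 a.1 / 2 + 2 := by
      refine le_of_sq_le_sq ?_ (by positivity)
      nlinarith [mul_le_mul_of_nonneg_right (pow_le_one₀ (n := 2) hδ.le hδ1) hq,
        sq_nonneg (a.2 a.1 / 2 - 2)]
    have hqle : a.2 a.1 ≤ 2 * (2 + |y₂ y₁|) := by
      linarith [le_abs_self (y₂ y₁)]
    have := mul_le_mul_of_nonneg_left hqle hδ.le
    linarith
  have := le_apply_zero_of_forall_pos (by fun_prop) key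
  simp at this
  linarith

theorem TypeNI.maxMonoSet (hAc : IsClosed (A : Set (E × StrongDual ℝ E)))
    (hA : MonoSet (A : Set (E × StrongDual ℝ E)))
    (hNI : TypeNI (A : Set (E × StrongDual ℝ E))) :
    MaxMonoSet (A : Set (E × StrongDual ℝ E)) := by
  refine ⟨hA, fun C hC hAC => (hAC.antisymm fun y hy => ?_).symm⟩
  have hrel : ∀ a ∈ A, 0 ≤ (a.2 - y.2) (a.1 - y.1) := fun a ha => hC.2 a (hAC ha) y hy
  suffices h : ∀ ε > 0, ∃ a ∈ A, (a.2 - y.2) (a.1 - y.1) + halfSq (a - y) < ε by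
    rw [← hAc.closure_eq, Metric.mem_closure_iff]
    intro ε hε
    obtain ⟨a, ha, hlt⟩ := h (ε ^ 2 / 2) (by positivity)
    refine ⟨a, ha, ?_⟩
    rw [dist_comm, dist_eq_norm]
    refine lt_of_pow_lt_pow_left₀ 2 hε.le ?_
    linarith [sq_norm_le_two_mul_halfSq (a - y), hrel a ha]
  intro ε hε
  by_contra! hge
  have hf : ConvexOn ℝ (A : Set (E × StrongDual ℝ E)) (fun a => (a.2 - y.2) (a.1 - y.1)) := by
    refine ⟨A.convex, fun a ha b hb s t hs ht hst => ?_⟩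
    have h := mul_nonneg (mul_nonneg hs ht) (hA.2 a ha b hb)
    obtain rfl : t = 1 - s := by linarith
    simp only [Prod.snd_add, Prod.smul_snd, Prod.fst_add, Prod.smul_fst, map_add, map_smul,
      add_apply, smul_apply, smul_eq_mul, map_sub,
      sub_apply] at h ⊢
    nlinarith
  have hk : ConvexOn ℝ Set.univ (fun b => halfSq (b - y)) := by
    simpa [Function.comp_def, sub_eq_add_neg] using
      (convexOn_halfSq (E := E)).translate_left (-y)
  obtain ⟨w, μ, hw₁, hw₂⟩ := exists_dual_separation ⟨0, A.zero_mem⟩ hf hk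
    (continuous_halfSq.comp (continuous_id.sub continuous_const)) hge
  have hμ : μ + w y ≤ -(‖dualFst w‖ ^ 2 / 2 + ‖dualSnd w‖ ^ 2 / 2) := by
    refine le_neg_of_forall_le_halfSq_sub fun b => ?_
    have := hw₁ (b + y)
    rw [add_sub_cancel_right, map_add] at this
    linarith
  obtain ⟨a, ha, hlt⟩ := hNI.exists_lt (y.2 - dualFst w)
    (inclusionInDoubleDual ℝ E y.1 - dualSnd w) hε
  have h₁ := hw₂ a ha
  have h₂ := neg_half_sq_norm_le w
  rw [dual_apply_eq] at h₁ hμ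
  simp only [sub_apply, map_sub, dual_def] at h₁ hlt
  linarith

theorem MonoSetBi.maxMonoSetBi (hA : MonoSet (A : Set (E × StrongDual ℝ E)))
    (hT : MonoSetBi (adjointSubspace (A : Set (E × StrongDual ℝ E)))) :
    MaxMonoSetBi (adjointSubspace (A : Set (E × StrongDual ℝ E))) := by
  refine ⟨hT, fun C hC hTC => (hTC.antisymm fun y hy => ?_).symm⟩
  have hrel : ∀ z ∈ adjointSubspace (A : Set (E × StrongDual ℝ E)),
      0 ≤ (z.1 - y.1) (z.2 - y.2) := fun z hz => hC.2 z (hTC hz) y hy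
  set L : StrongDual ℝ (E × StrongDual ℝ E) := y.2.coprod (-y.1)
  have hL : ∀ a, L a = y.2 a.1 - y.1 a.2 := fun a => by simp [L, sub_eq_add_neg]
  set S : Set ℝ := (fun a => a.2 a.1 - L a + halfSq a) '' (A : Set (E × StrongDual ℝ E))
  have hSne : S.Nonempty := ⟨_, 0, A.zero_mem, rfl⟩
  have hSb : BddBelow S := by
    refine ⟨-(‖dualFst L‖ ^ 2 / 2 + ‖dualSnd L‖ ^ 2 / 2), ?_⟩
    rintro _ ⟨a, ha, rfl⟩
    have h₁ := hA.apply_nonneg ha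
    have h₂ := neg_half_sq_norm_le_halfSq_sub L a
    simp only
    linarith
  have hf : ConvexOn ℝ (A : Set (E × StrongDual ℝ E)) (fun a => a.2 a.1 - L a) :=
    hA.convexOn.sub (L.toLinearMap.concaveOn A.convex)
  have hinf : ∀ b ∈ A, sInf S ≤ b.2 b.1 - L b + halfSq b := fun b hb =>
    csInf_le hSb ⟨b, hb, rfl⟩
  obtain ⟨w, μ, hw₁, hw₂⟩ := exists_dual_separation ⟨0, A.zero_mem⟩ hf convexOn_halfSq
    continuous_halfSq hinf
  have hμ := le_neg_of_forall_le_halfSq_sub hw₁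
  have key : ∀ δ : ℝ, 0 < δ → δ ≤ 1 →
      -sInf S ≤ ‖L‖ * √(2 * (6 * δ ^ 2 + 4 * δ * ‖w‖)) + δ ^ 2 := by
    intro δ hδ _
    obtain ⟨_, ⟨a, ha, rfl⟩, hlt⟩ := exists_lt_of_csInf_lt hSne
      (lt_add_of_pos_right (sInf S) (pow_pos hδ 2))
    simp only at hlt
    obtain ⟨W, hWn, hWa, hWA⟩ := exists_extension_of_forall_sub_le (L - w) ha hδ.le fun b hb => by
      have h₁ := hw₂ b hb
      have h₂ := hw₁ a
      simp only [sub_apply]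
      linarith
    have h₁ := apply_sub_add_le_zero (A := A) (W := W - w) hrel (a := a) fun b hb => by
      rw [sub_apply, hWA b hb, sub_apply, hL]
      ring
    have h₂ := hw₂ a ha
    have hq := hA.apply_nonneg ha
    have e₁ := (abs_le.1 (abs_dualSnd_dualFst_le w W)).2
    have e₂ := (abs_le.1 (abs_dualSnd_dualFst_le W w)).2
    have e₃ := (abs_le.1 (abs_dualSnd_dualFst_le W W)).1
    have hwn := norm_nonneg w
    have hWn' := norm_nonneg W
    have e₄ : ‖w‖ * ‖W‖ ≤ ‖w‖ * (2 * δ) := by gcongr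
    have e₅ : ‖W‖ * ‖W‖ ≤ (2 * δ) * (2 * δ) := by gcongr
    have hexp : dualSnd (W - w) (dualFst (W - w)) = dualSnd W (dualFst W) - dualSnd W (dualFst w)
        - dualSnd w (dualFst W) + dualSnd w (dualFst w) := by
      change (dualSnd W - dualSnd w) (dualFst W - dualFst w) = _
      simp only [map_sub, sub_apply]
      ring
    rw [hexp, sub_apply] at h₁
    have hWle : W a ≤ a.2 a.1 + δ ^ 2 := by
      refine le_of_sq_le_sq ?_ (by positivity)
      nlinarith [sq_nonneg (a.2 a.1 - δ ^ 2)]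
    have h₃ := neg_half_sq_norm_le w
    have hhalf : halfSq a ≤ 6 * δ ^ 2 + 4 * δ * ‖w‖ := by linarith
    have hnorm : ‖a‖ ≤ √(2 * (6 * δ ^ 2 + 4 * δ * ‖w‖)) :=
      Real.le_sqrt_of_sq_le (by linarith [sq_norm_le_two_mul_halfSq a])
    have hLa : L a ≤ ‖L‖ * √(2 * (6 * δ ^ 2 + 4 * δ * ‖w‖)) :=
      ((le_abs_self _).trans (L.le_opNorm a)).trans (by gcongr)
    have hpos : 0 ≤ halfSq a := by unfold halfSq; positivity
    linarith
  have hm := le_apply_zero_of_forall_pos (by fun_prop) key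
  simp only [ne_eq, OfNat.ofNat_ne_zero, not_false_eq_true, zero_pow, mul_zero, zero_mul,
    add_zero, Real.sqrt_zero] at hm
  intro b hb
  have hdisc := discrim_le_zero (a := b.2 b.1 + halfSq b) (b := -L b) (c := 0) fun t => by
    have h := hinf (t • b) (A.smul_mem t hb)
    have hsq : halfSq (t • b) = t ^ 2 * halfSq b := by
      simp only [halfSq, Prod.smul_fst, Prod.smul_snd, norm_smul, mul_pow, Real.norm_eq_abs,
        sq_abs]
      ring
    simp only [hsq, Prod.smul_snd, Prod.smul_fst, map_smul, smul_apply,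
      smul_eq_mul] at h
    linarith
  have hLb : L b = 0 := by
    rw [discrim] at hdisc
    nlinarith [sq_nonneg (L b)]
  rw [hL] at hLb
  linarith

end Monotone

/-- Corollary 6.6. Let `A` be a closed linear monotone subspace of
`E × E*`.  Then the following are equivalent: (i) `Aᵀ` is monotone; (ii) `A` is maximally
monotone and of type (NI); (iii) `A` is of type (NI); (iv) `Aᵀ` is maximally monotone. -/
theorem adjoint_mono_tfae [CompleteSpace E] [Nontrivial E]
    (A : Submodule ℝ (E × StrongDual ℝ E)) (hAc : IsClosed (A : Set (E × StrongDual ℝ E)))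
    (hAmono : MonoSet (A : Set (E × StrongDual ℝ E))) :
    (MonoSetBi (adjointSubspace (A : Set (E × StrongDual ℝ E))) ↔
      (MaxMonoSet (A : Set (E × StrongDual ℝ E)) ∧ TypeNI (A : Set (E × StrongDual ℝ E)))) ∧
    ((MaxMonoSet (A : Set (E × StrongDual ℝ E)) ∧ TypeNI (A : Set (E × StrongDual ℝ E))) ↔
      TypeNI (A : Set (E × StrongDual ℝ E))) ∧
    (TypeNI (A : Set (E × StrongDual ℝ E)) ↔
      MaxMonoSetBi (adjointSubspace (A : Set (E × StrongDual ℝ E)))) := by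
  have h₁₃ := MonoSetBi.typeNI hAmono
  have h₃₁ := TypeNI.monoSetBi_adjointSubspace hAmono
  have h₃₂ := TypeNI.maxMonoSet hAc hAmono
  have h₁₄ := MonoSetBi.maxMonoSetBi hAmono
  exact ⟨⟨fun h => ⟨h₃₂ (h₁₃ h), h₁₃ h⟩, fun h => h₃₁ h.2⟩, ⟨And.right, fun h => ⟨h₃₂ h, h⟩⟩,
    fun h => h₁₄ (h₃₁ h), fun h => h₁₃ h.1⟩
end

section
/- Let E be a reflexive nonzero real Banach space and A be a closed linear monotone subspace of E × E*. Then A is maximally monotone if, and only if, the adjoint subspace Aᵀ is monotone. -/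
open NormedSpace

variable {E : Type*} [NormedAddCommGroup E] [NormedSpace ℝ E]

/-- Sandwich theorem: a convex function on a nonempty convex set that dominates a continuous
concave function there is separated from it by a continuous affine function. -/
lemma exists_affine_between {B : Type*} [NormedAddCommGroup B] [NormedSpace ℝ B] {A : Set B}
    (hA : A.Nonempty) {F G : B → ℝ} (hF : ConvexOn ℝ A F) (hG : ConvexOn ℝ Set.univ G)
    (hGc : Continuous G) (h : ∀ a ∈ A, 0 ≤ F a + G a) :
    ∃ (φ : StrongDual ℝ B) (r : ℝ), (∀ a ∈ A, φ a + r ≤ F a) ∧ ∀ b, -G b ≤ φ b + r := by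
  have hU : Convex ℝ {p : B × ℝ | G p.1 < p.2} := by
    simpa using hG.convex_strict_epigraph
  have hUo : IsOpen {p : B × ℝ | G p.1 < p.2} :=
    isOpen_lt (hGc.comp continuous_fst) continuous_snd
  have hV : Convex ℝ {p : B × ℝ | p.1 ∈ A ∧ p.2 ≤ -F p.1} :=
    hF.neg.convex_hypograph
  have hdisj : Disjoint {p : B × ℝ | G p.1 < p.2} {p : B × ℝ | p.1 ∈ A ∧ p.2 ≤ -F p.1} := by
    refine Set.disjoint_left.2 fun p (hp : G p.1 < p.2) hq => ?_
    have := h p.1 hq.1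
    linarith [hq.2]
  obtain ⟨f, u, hfU, hfV⟩ := geometric_hahn_banach_open hU hUo hV hdisj
  have hf : ∀ b t, f (b, t) = f (b, 0) + t * f (0, 1) := fun b t => by
    have : ((b, t) : B × ℝ) = (b, 0) + t • ((0 : B), (1 : ℝ)) := by simp
    rw [this, map_add, map_smul, smul_eq_mul]
  set s := f (0, 1)
  obtain ⟨a₀, ha₀⟩ := hA
  have hs : s < 0 := by
    have h1 := hfU (a₀, G a₀ + 1) (by simp)
    have h2 := hfV (a₀, -F a₀) ⟨ha₀, le_rfl⟩
    rw [hf] at h1 h2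
    have := h a₀ ha₀
    by_contra! hs
    nlinarith
  refine ⟨s⁻¹ • f.comp (ContinuousLinearMap.inl ℝ B ℝ), -(s⁻¹ * u), fun a ha => ?_, fun b => ?_⟩
  · have h2 := hfV (a, -F a) ⟨ha, le_rfl⟩
    rw [hf] at h2
    have : s⁻¹ * (f (a, 0) + -F a * s) ≤ s⁻¹ * u :=
      mul_le_mul_of_nonpos_left h2 (inv_nonpos.2 hs.le)
    have e : s⁻¹ * (f (a, 0) + -F a * s) = s⁻¹ * f (a, 0) - F a := by
      linear_combination -(F a) * inv_mul_cancel₀ hs.ne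
    simp only [smul_apply, ContinuousLinearMap.comp_apply,
      ContinuousLinearMap.inl_apply, smul_eq_mul]
    linarith
  · have h1 : f (b, 0) + G b * s ≤ u := by
      refine le_of_forall_pos_lt_add fun ε hε => ?_
      have h1 := hfU (b, G b + ε / -s) (by simpa using div_pos hε (neg_pos.2 hs))
      rw [hf] at h1
      have : (G b + ε / -s) * s = G b * s - ε := by
        linear_combination -(div_mul_cancel₀ ε (neg_ne_zero.2 hs.ne))
      linarith
    have : s⁻¹ * u ≤ s⁻¹ * (f (b, 0) + G b * s) :=
      mul_le_mul_of_nonpos_left h1 (inv_nonpos.2 hs.le)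
    have e : s⁻¹ * (f (b, 0) + G b * s) = s⁻¹ * f (b, 0) + G b := by
      linear_combination (G b) * inv_mul_cancel₀ hs.ne
    simp only [smul_apply, ContinuousLinearMap.comp_apply,
      ContinuousLinearMap.inl_apply, smul_eq_mul]
    linarith

lemma sq_le_four_mul_of_forall_nonneg {α β γ : ℝ} (h : ∀ t : ℝ, 0 ≤ γ - t * β + t ^ 2 * α) :
    β ^ 2 ≤ 4 * α * γ := by
  have := discrim_le_zero (a := α) (b := -β) (c := γ) fun t => by linarith [h t]
  rw [discrim] at this
  linarith

/-- The conjugate of `½‖·‖²` is at least `½‖·‖²` on the dual. -/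
lemma half_norm_sq_le_of_forall_sub_le {F : Type*} [NormedAddCommGroup F] [NormedSpace ℝ F]
    {d : StrongDual ℝ F} {K : ℝ} (h : ∀ u, d u - ‖u‖ ^ 2 / 2 ≤ K) : ‖d‖ ^ 2 / 2 ≤ K := by
  have hK : 0 ≤ K := by simpa using h 0
  have key : ‖d‖ ≤ √(2 * K) := by
    refine d.opNorm_le_bound (Real.sqrt_nonneg _) fun u => ?_
    have := sq_le_four_mul_of_forall_nonneg (α := ‖u‖ ^ 2 / 2) (β := d u) (γ := K) fun t => by
      have := h (t • u)
      rw [map_smul, norm_smul, mul_pow, Real.norm_eq_abs, sq_abs, smul_eq_mul] at this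
      linarith
    refine abs_le_of_sq_le_sq (a := d u) ?_ (by positivity)
    rw [mul_pow, Real.sq_sqrt (by positivity)]
    linarith
  have := pow_le_pow_left₀ (norm_nonneg d) key 2
  rw [Real.sq_sqrt (by positivity)] at this
  linarith

/-- In a reflexive space, every functional on `E × E*` is represented by an element of
`E × E*` via the natural symmetric pairing. -/
lemma exists_repr_of_reflexive
    (hrefl : Function.Surjective (⇑(inclusionInDoubleDual ℝ E)))
    (φ : StrongDual ℝ (E × StrongDual ℝ E)) :
    ∃ d : E × StrongDual ℝ E, (∀ b, φ b = d.2 b.1 + b.2 d.1) ∧ ‖d.1‖ ≤ ‖φ‖ ∧ ‖d.2‖ ≤ ‖φ‖ := by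
  obtain ⟨y, hy⟩ := hrefl (φ.comp (ContinuousLinearMap.inr ℝ E (StrongDual ℝ E)))
  refine ⟨(y, φ.comp (ContinuousLinearMap.inl ℝ E (StrongDual ℝ E))), fun b => ?_, ?_, ?_⟩
  · have := DFunLike.congr_fun hy b.2
    rw [dual_def] at this
    simp only [this, ContinuousLinearMap.comp_apply, ContinuousLinearMap.inl_apply,
      ContinuousLinearMap.inr_apply, ← map_add]
    simp
  · have : ‖inclusionInDoubleDual ℝ E y‖ = ‖y‖ := (inclusionInDoubleDualLi ℝ).norm_map y
    rw [← this, hy]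
    refine ContinuousLinearMap.opNorm_le_bound _ (norm_nonneg φ) fun u => ?_
    refine (φ.le_opNorm _).trans_eq ?_
    simp [Prod.norm_def]
  · refine ContinuousLinearMap.opNorm_le_bound _ (norm_nonneg φ) fun u => ?_
    refine (φ.le_opNorm _).trans_eq ?_
    simp [Prod.norm_def]

lemma neg_mul_norm_le_apply (f : StrongDual ℝ E) (x : E) : -(‖f‖ * ‖x‖) ≤ f x :=
  (abs_le.1 (f.le_opNorm x)).1

lemma apply_le_mul_norm (f : StrongDual ℝ E) (x : E) : f x ≤ ‖f‖ * ‖x‖ :=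
  (abs_le.1 (f.le_opNorm x)).2

/-- On a monotone linear subspace, the translated duality form is convex. -/
lemma convexOn_apply_sub (A : Submodule ℝ (E × StrongDual ℝ E)) (hA : ∀ a ∈ A, 0 ≤ a.2 a.1)
    (c : E × StrongDual ℝ E) (m : ℝ) :
    ConvexOn ℝ (A : Set (E × StrongDual ℝ E)) fun a => (c - a).2 (c - a).1 - m := by
  refine ⟨A.convex, fun a ha b hb s t hs ht hst => ?_⟩
  have h := mul_nonneg (mul_nonneg hs ht) (hA _ (A.sub_mem ha hb))
  obtain rfl : t = 1 - s := by linarith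
  simp only [Prod.fst_sub, Prod.snd_sub, Prod.fst_add, Prod.snd_add, Prod.smul_fst, Prod.smul_snd,
    sub_apply, add_apply, smul_apply,
    map_sub, map_add, map_smul, smul_eq_mul] at h ⊢
  linarith

lemma convexOn_half_norm_sq_sub (c : E × StrongDual ℝ E) :
    ConvexOn ℝ Set.univ fun b : E × StrongDual ℝ E =>
      ‖(c - b).1‖ ^ 2 / 2 + ‖(c - b).2‖ ^ 2 / 2 := by
  have key : ∀ {F : Type _} [NormedAddCommGroup F] [NormedSpace ℝ F] (x y z : F) (s t : ℝ),
      0 ≤ s → 0 ≤ t → s + t = 1 →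
      ‖x - (s • y + t • z)‖ ^ 2 ≤ s * ‖x - y‖ ^ 2 + t * ‖x - z‖ ^ 2 := by
    intro F _ _ x y z s t hs ht hst
    have e : x - (s • y + t • z) = s • (x - y) + t • (x - z) := by
      obtain rfl : t = 1 - s := by linarith
      module
    have h1 : ‖x - (s • y + t • z)‖ ≤ s * ‖x - y‖ + t * ‖x - z‖ := by
      rw [e]
      refine (norm_add_le _ _).trans_eq ?_
      rw [norm_smul, norm_smul, Real.norm_of_nonneg hs, Real.norm_of_nonneg ht]
    refine (pow_le_pow_left₀ (norm_nonneg _) h1 2).trans ?_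
    have := mul_nonneg (mul_nonneg hs ht) (sq_nonneg (‖x - y‖ - ‖x - z‖))
    obtain rfl : t = 1 - s := by linarith
    linarith
  refine ⟨convex_univ, fun a _ b _ s t hs ht hst => ?_⟩
  have h1 := key c.1 a.1 b.1 s t hs ht hst
  have h2 := key c.2 a.2 b.2 s t hs ht hst
  simp only [Prod.fst_sub, Prod.snd_sub, Prod.fst_add, Prod.snd_add, Prod.smul_fst, Prod.smul_snd,
    smul_eq_mul]
  linarith

/-- With `q(b) = ⟨b.1, b.2⟩`, a multiplier `d` for minimizing `q(c - a) + ½‖c - a‖²` over `A`, and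
approximate minimizers `a` at which the complementarity and stationarity conditions hold up to an
arbitrarily small error. -/
lemma exists_multiplier (hrefl : Function.Surjective (⇑(inclusionInDoubleDual ℝ E)))
    (A : Submodule ℝ (E × StrongDual ℝ E)) (hA : ∀ a ∈ A, 0 ≤ a.2 a.1)
    (c : E × StrongDual ℝ E) (hc : ∀ a ∈ A, 0 ≤ (c - a).2 (c - a).1) :
    ∃ d : E × StrongDual ℝ E, ∀ ε > 0, ∃ a ∈ A,
      ‖(c - a).1‖ ^ 2 / 2 + ‖(c - a).2‖ ^ 2 / 2 + ‖d.1‖ ^ 2 / 2 + ‖d.2‖ ^ 2 / 2 - ε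
        ≤ d.2 (c - a).1 + (c - a).2 d.1 ∧
      ∀ v ∈ A, ((c - a + d).2 v.1 + v.2 (c - a + d).1) ^ 2 ≤ 4 * v.2 v.1 * ε := by
  let G : E × StrongDual ℝ E → ℝ := fun b => ‖(c - b).1‖ ^ 2 / 2 + ‖(c - b).2‖ ^ 2 / 2
  let S : Set ℝ := (fun a => (c - a).2 (c - a).1 + G a) '' (A : Set (E × StrongDual ℝ E))
  have hSne : S.Nonempty := ⟨_, 0, A.zero_mem, rfl⟩
  have hSbdd : BddBelow S := by
    refine ⟨0, ?_⟩
    rintro _ ⟨a, ha, rfl⟩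
    have := hc a ha
    positivity
  obtain ⟨φ, r, hφA, hφ⟩ := exists_affine_between ⟨0, A.zero_mem⟩
    (convexOn_apply_sub A hA c (sInf S)) (convexOn_half_norm_sq_sub c) (by fun_prop)
    fun a ha => by
      have := csInf_le hSbdd ⟨a, ha, rfl⟩
      simp only [G] at this
      linarith
  obtain ⟨d, hd, -⟩ := exists_repr_of_reflexive hrefl φ
  have hdn : ‖d.1‖ ^ 2 / 2 + ‖d.2‖ ^ 2 / 2 ≤ φ c + r := by
    have h1 : ∀ u : E × StrongDual ℝ E,
        d.2 u.1 + u.2 d.1 - (‖u.1‖ ^ 2 / 2 + ‖u.2‖ ^ 2 / 2) ≤ φ c + r := fun u => by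
      have := hφ (c - u)
      rw [sub_sub_cancel, map_sub, hd u] at this
      linarith
    have h2 : ∀ u₂ : StrongDual ℝ E,
        ‖d.2‖ ^ 2 / 2 ≤ φ c + r - (u₂ d.1 - ‖u₂‖ ^ 2 / 2) := fun u₂ =>
      half_norm_sq_le_of_forall_sub_le fun u₁ => by linarith [h1 (u₁, u₂)]
    have h3 : ‖inclusionInDoubleDual ℝ E d.1‖ ^ 2 / 2 ≤ φ c + r - ‖d.2‖ ^ 2 / 2 :=
      half_norm_sq_le_of_forall_sub_le fun u₂ => by rw [dual_def]; linarith [h2 u₂]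
    have : ‖inclusionInDoubleDual ℝ E d.1‖ = ‖d.1‖ := (inclusionInDoubleDualLi ℝ).norm_map d.1
    rw [this] at h3
    linarith
  refine ⟨d, fun ε hε => ?_⟩
  obtain ⟨_, ⟨a, ha, rfl⟩, hlt⟩ := exists_lt_of_csInf_lt hSne (lt_add_of_pos_right (sInf S) hε)
  have hgap := hφA a ha
  have hda := hd (c - a)
  rw [map_sub] at hda
  simp only [G] at hlt
  refine ⟨a, ha, by linarith, fun v hv => sq_le_four_mul_of_forall_nonneg fun t => ?_⟩
  have h := hφA (a + t • v) (A.add_mem ha (A.smul_mem t hv))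
  have hdv := hd v
  have hG : 0 ≤ ‖(c - a).1‖ ^ 2 / 2 + ‖(c - a).2‖ ^ 2 / 2 := by positivity
  have hφa := hφ a
  simp only [Prod.fst_sub, Prod.snd_sub, Prod.fst_add, Prod.snd_add, Prod.smul_fst, Prod.smul_snd,
    sub_apply, add_apply, smul_apply,
    map_sub, map_add, map_smul, smul_eq_mul] at h hdv hgap hlt hφa ⊢
  rw [hdv] at h
  linarith

/-- If `⟨z.1, z.2⟩ ≤ 0` on the annihilator of `A` for the symmetric pairing, a point monotonically related
to the monotone subspace `A` can be approximated by points of `A`. -/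
lemma exists_mem_norm_sub_sq_le (hrefl : Function.Surjective (⇑(inclusionInDoubleDual ℝ E)))
    (A : Submodule ℝ (E × StrongDual ℝ E)) (hA : ∀ a ∈ A, 0 ≤ a.2 a.1)
    (hneg : ∀ z : E × StrongDual ℝ E, (∀ v ∈ A, z.2 v.1 + v.2 z.1 = 0) → z.2 z.1 ≤ 0)
    (c : E × StrongDual ℝ E) (hc : ∀ a ∈ A, 0 ≤ (c - a).2 (c - a).1) :
    ∃ D : ℝ, ∀ δ > 0, ∃ a ∈ A,
      (‖(c - a).1‖ - δ) ^ 2 + (‖(c - a).2‖ - δ) ^ 2 ≤ D * δ + 6 * δ ^ 2 := by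
  obtain ⟨d, hd⟩ := exists_multiplier hrefl A hA c hc
  refine ⟨2 * (‖d.1‖ + ‖d.2‖), fun δ hδ => ?_⟩
  obtain ⟨a, ha, hcomp, hstat⟩ := hd (δ ^ 2 / 4) (by positivity)
  refine ⟨a, ha, ?_⟩
  have hq := hc a ha
  set w := c - a
  let ψ : StrongDual ℝ (E × StrongDual ℝ E) :=
    (w + d).2.comp (ContinuousLinearMap.fst ℝ E (StrongDual ℝ E)) +
      (inclusionInDoubleDual ℝ E (w + d).1).comp (ContinuousLinearMap.snd ℝ E (StrongDual ℝ E))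
  have hψ : ∀ v, ψ v = (w + d).2 v.1 + v.2 (w + d).1 := fun v => rfl
  obtain ⟨η, hη, hηn⟩ := exists_extension_norm_eq A (ψ.comp A.subtypeL)
  have hηδ : ‖η‖ ≤ δ := by
    rw [hηn]
    refine ContinuousLinearMap.opNorm_le_bound _ hδ.le fun v => ?_
    have h1 := hstat v v.2
    have h2 : (v : E × StrongDual ℝ E).2 (v : E × StrongDual ℝ E).1 ≤ ‖v‖ ^ 2 := by
      refine (apply_le_mul_norm _ _).trans ?_
      rw [sq]
      exact mul_le_mul (norm_snd_le _) (norm_fst_le _) (norm_nonneg _) (norm_nonneg _)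
    have h3 := mul_le_mul_of_nonneg_left h2 (sq_nonneg δ)
    refine abs_le_of_sq_le_sq (a := ψ v) ?_ (by positivity)
    rw [hψ, mul_pow]
    linarith
  obtain ⟨e, he, he1, he2⟩ := exists_repr_of_reflexive hrefl η
  have hz := hneg (w + d - e) fun v hv => by
    have h1 := hη ⟨v, hv⟩
    have h2 : η v = ψ v := h1
    rw [he, hψ] at h2
    simp only [Prod.fst_sub, Prod.snd_sub, sub_apply, map_sub]
    linarith
  have hcross : (w + d).2 e.1 + e.2 (w + d).1 ≤ (‖w.1‖ + ‖w.2‖ + ‖d.1‖ + ‖d.2‖) * δ := by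
    have h1 := apply_le_mul_norm (w + d).2 e.1
    have h2 := apply_le_mul_norm e.2 (w + d).1
    have h3 : ‖(w + d).2‖ * ‖e.1‖ ≤ (‖w.2‖ + ‖d.2‖) * δ :=
      mul_le_mul (norm_add_le _ _) (he1.trans hηδ) (norm_nonneg _) (by positivity)
    have h4 : ‖e.2‖ * ‖(w + d).1‖ ≤ δ * (‖w.1‖ + ‖d.1‖) :=
      mul_le_mul (he2.trans hηδ) (norm_add_le _ _) (norm_nonneg _) hδ.le
    linarith
  have hqe : -(δ * δ) ≤ e.2 e.1 := by
    have h1 := neg_mul_norm_le_apply e.2 e.1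
    have h2 : ‖e.2‖ * ‖e.1‖ ≤ δ * δ :=
      mul_le_mul (he2.trans hηδ) (he1.trans hηδ) (norm_nonneg _) hδ.le
    linarith
  have hqd := neg_mul_norm_le_apply d.2 d.1
  have hsq := sq_nonneg (‖d.2‖ - ‖d.1‖)
  simp only [Prod.fst_sub, Prod.snd_sub, Prod.fst_add, Prod.snd_add,
    sub_apply, add_apply, map_sub, map_add] at hz hcross
  nlinarith

/-- Corollary 6.7, Brezis–Browder. Let `E` be reflexive (the canonical
embedding `E → E**` is surjective) and `A` a closed linear monotone subspace of `E × E*`.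
Then `A` is maximally monotone iff `Aᵀ` is monotone. -/
theorem maxMono_iff_adjoint_mono_of_reflexive [CompleteSpace E] [Nontrivial E]
    (hrefl : Function.Surjective (⇑(inclusionInDoubleDual ℝ E)))
    (A : Submodule ℝ (E × StrongDual ℝ E)) (hAc : IsClosed (A : Set (E × StrongDual ℝ E)))
    (hAmono : MonoSet (A : Set (E × StrongDual ℝ E))) :
    MaxMonoSet (A : Set (E × StrongDual ℝ E)) ↔
      MonoSetBi (adjointSubspace (A : Set (E × StrongDual ℝ E))) := by
  have hA : ∀ a ∈ A, 0 ≤ a.2 a.1 := fun a ha => by simpa using hAmono.2 a ha 0 A.zero_mem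
  constructor
  · rintro ⟨-, hmax⟩
    refine ⟨⟨0, fun a _ => by simp⟩, fun p hp q hq => ?_⟩
    obtain ⟨y, hy⟩ := hrefl (p.1 - q.1)
    rw [← hy, dual_def]
    set f := p.2 - q.2
    have hyf : ∀ a ∈ A, f a.1 = a.2 y := fun a ha => by
      have h1 := DFunLike.congr_fun hy a.2
      rw [dual_def] at h1
      simp [f, h1, hp a ha, hq a ha]
    by_contra! hlt
    have hpos : ∀ a ∈ A, 0 ≤ (-f - a.2) (y - a.1) := fun a ha => by
      have h1 := hyf a ha
      have h2 := hA a ha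
      simp only [sub_apply, neg_apply, map_sub]
      linarith
    have hins : MonoSet (insert (y, -f) (A : Set (E × StrongDual ℝ E))) := by
      refine ⟨⟨_, Set.mem_insert _ _⟩, ?_⟩
      rintro b (rfl | hb) b' (rfl | hb')
      · simp
      · exact hpos b' hb'
      · have := hpos b hb
        simp only [map_sub, sub_apply, neg_apply] at this ⊢
        linarith
      · exact hAmono.2 b hb b' hb'
    have hmem : (y, -f) ∈ A := by
      rw [← SetLike.mem_coe, ← hmax _ hins (Set.subset_insert _ _)]
      exact Set.mem_insert _ _
    have := hyf _ hmem
    simp only [neg_apply] at this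
    linarith
  · rintro ⟨-, hadj⟩
    refine ⟨hAmono, fun C hC hAC => Set.Subset.antisymm (fun c hcC => ?_) hAC⟩
    obtain ⟨D, hD⟩ := exists_mem_norm_sub_sq_le hrefl A hA
      (fun z hz => by
        have h0 : ((inclusionInDoubleDual ℝ E z.1, -z.2) :
            StrongDual ℝ (StrongDual ℝ E) × StrongDual ℝ E) ∈
            adjointSubspace (A : Set (E × StrongDual ℝ E)) := fun a ha => by
          have := hz a ha
          simp only [neg_apply, dual_def]
          linarith
        have := hadj _ h0 0 (fun a _ => by simp)
        simpa using this)
      c fun a ha => hC.2 c hcC a (hAC ha)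
    rw [← hAc.closure_eq, Metric.mem_closure_iff]
    intro ρ hρ
    have hlim : Filter.Tendsto (fun δ : ℝ => δ + √(D * δ + 6 * δ ^ 2)) (nhdsWithin 0 (Set.Ioi 0))
        (nhds 0) := by
      have : Continuous fun δ : ℝ => δ + √(D * δ + 6 * δ ^ 2) := by fun_prop
      simpa using (this.tendsto 0).mono_left nhdsWithin_le_nhds
    obtain ⟨δ, hδρ, hδ⟩ := ((hlim.eventually_lt_const hρ).and self_mem_nhdsWithin).exists
    obtain ⟨a, ha, h⟩ := hD δ hδ
    refine ⟨a, ha, ?_⟩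
    have h1 : ‖(c - a).1‖ - δ ≤ √(D * δ + 6 * δ ^ 2) :=
      Real.le_sqrt_of_sq_le (by linarith [sq_nonneg (‖(c - a).2‖ - δ)])
    have h2 : ‖(c - a).2‖ - δ ≤ √(D * δ + 6 * δ ^ 2) :=
      Real.le_sqrt_of_sq_le (by linarith [sq_nonneg (‖(c - a).1‖ - δ)])
    rw [dist_eq_norm, Prod.norm_def]
    exact max_lt (by linarith) (by linarith)
end
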